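/- Under condition (A2), the tail distribution satisfies F̄(e^{ζ/√k} b(n/k)) = (k/n)(1 − αζ/√k + o(1/√k)) as n → ∞, uniformly in ζ over every compact subset of ℝ; that is, for every compact set C ⊂ ℝ, sup_{ζ ∈ C} √k | (n/k) F̄(e^{ζ/√k} b(n/k)) − 1 + αζ/√k | → 0. -/

import Mathlib

open MeasureTheory ProbabilityTheory Filter Set
open scoped ProbabilityTheory

noncomputable section

namespace TailCusum

variable {Ω : Type*} [MeasureSpace Ω]

/-- `φ₁(x) = 1{x > 0}`. -/
def phi1 (x : ℝ) : ℝ := if 0 < x then 1 else 0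

/-- `φ₂(x) = x₊ = max {x, 0}`. -/
def phi2 (x : ℝ) : ℝ := max x 0

/-- positive part -/
def pos (x : ℝ) : ℝ := max x 0

/-- A positive measurable function `g` is regularly varying at `∞` with index `ρ` if
`g(λ x)/g(x) → λ^ρ` as `x → ∞` for every `λ > 0`. -/
def RegularlyVarying (g : ℝ → ℝ) (ρ : ℝ) : Prop :=
  Measurable g ∧ ∀ lam : ℝ, 0 < lam →
    Tendsto (fun x => g (lam * x) / g x) atTop (nhds (lam ^ ρ))

/-- `l` is slowly varying at `∞`. -/
def SlowlyVarying (l : ℝ → ℝ) : Prop :=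
  Measurable l ∧ ∀ lam : ℝ, 0 < lam →
    Tendsto (fun x => l (lam * x) / l x) atTop (nhds 1)

/-- `κ(λ) = K ∫_1^λ t^(γ-1) dt`. -/
def kappaFun (K γ : ℝ) (lam : ℝ) : ℝ := K * ∫ t in (1:ℝ)..lam, t ^ (γ - 1)

/-- Second-order regular variation condition on the slowly varying function `l`
(the core of condition (A2)): `(l(λx)/l(x) - 1)/g(x) → κ(λ)` with
`κ(λ) = K ∫_1^λ t^(γ-1) dt`, `g` positive and regularly varying with index `γ ≤ 0`. -/
def SecondOrderRV (l g : ℝ → ℝ) (K γ : ℝ) : Prop :=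
  γ ≤ 0 ∧ (∀ x, 0 < g x) ∧ RegularlyVarying g γ ∧
  ∀ lam : ℝ, 0 < lam →
    Tendsto (fun x => (l (lam * x) / l x - 1) / g x) atTop (nhds (kappaFun K γ lam))

/-- distribution function of a law on `ℝ` -/
def df (μ : Measure ℝ) (x : ℝ) : ℝ := (μ (Iic x)).toReal

/-- tail distribution function `F̄(x) = μ(x, ∞)` -/
def tailDF (μ : Measure ℝ) (x : ℝ) : ℝ := (μ (Ioi x)).toReal

/-- the quantile-type function `b(x) = inf {y : F(y) ≥ 1 - x⁻¹}` -/
def quantileB (μ : Measure ℝ) (x : ℝ) : ℝ := sInf {y : ℝ | 1 - x⁻¹ ≤ df μ y}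

/-- `F̄(x) = x^(-α) l(x)` for `x > 0` with `l` slowly varying: Pareto-type tail. -/
def ParetoTail (μ : Measure ℝ) (α : ℝ) (l : ℝ → ℝ) : Prop :=
  SlowlyVarying l ∧ ∀ x : ℝ, 0 < x → tailDF μ x = x ^ (-α) * l x

/-- strict stationarity of a sequence of random variables -/
def IsStationary (X : ℕ → Ω → ℝ) : Prop :=
  ∀ j : ℕ,
    Measure.map (fun ω => fun i : ℕ => X (i + j) ω) (ℙ : Measure Ω)
      = Measure.map (fun ω => fun i : ℕ => X i ω) (ℙ : Measure Ω)

/-- strict stationarity, `ℤ`-indexed -/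
def IsStationaryZ (X : ℤ → Ω → ℝ) : Prop :=
  ∀ j : ℤ,
    Measure.map (fun ω => fun i : ℤ => X (i + j) ω) (ℙ : Measure Ω)
      = Measure.map (fun ω => fun i : ℤ => X i ω) (ℙ : Measure Ω)

/-- The β-mixing coefficient of the sequence `X` at lag `lag`, expressed as
the supremum over `m` of the total-variation distance between the joint law of
`(X_1, …, X_m)` and `(X_{m+lag+1}, X_{m+lag+2}, …)` and the product of the two laws. -/
def betaMix (X : ℕ → Ω → ℝ) (lag : ℕ) : ℝ :=
  ⨆ m : ℕ, ⨆ S : Subtype (MeasurableSet : Set ((Fin m → ℝ) × (ℕ → ℝ)) → Prop),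
    |((Measure.map
        (fun ω => ((fun i : Fin m => X ((i : ℕ) + 1) ω, fun i : ℕ => X (m + lag + 1 + i) ω)))
        (ℙ : Measure Ω)) S.1).toReal
      - (((Measure.map (fun ω => fun i : Fin m => X ((i : ℕ) + 1) ω) (ℙ : Measure Ω)).prod
          (Measure.map (fun ω => fun i : ℕ => X (m + lag + 1 + i) ω) (ℙ : Measure Ω))) S.1).toReal|

/-- The tail sample fraction condition: `k → ∞` and `k = o(n)`. -/
def TailFraction (k : ℕ → ℕ) : Prop :=
  Tendsto (fun n : ℕ => (k n : ℝ)) atTop atTop ∧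
    Tendsto (fun n : ℕ => (k n : ℝ) / n) atTop (nhds 0)

/-- Condition (A1): `(n / r_n) β([ε r_n]) → 0` for every `ε > 0`, and `r_n² = o(k)`. -/
def CondA1 (X : ℕ → Ω → ℝ) (k r : ℕ → ℕ) : Prop :=
  (∀ n, 0 < r n) ∧
  (∀ ε : ℝ, 0 < ε →
    Tendsto (fun n : ℕ => ((n : ℝ) / r n) * betaMix X ⌊ε * r n⌋₊) atTop (nhds 0)) ∧
  Tendsto (fun n : ℕ => ((r n : ℝ) ^ 2 / k n)) atTop (nhds 0)

/-- Condition (A2): second-order regular variation of `l` plus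
`√k · g(b(n/k)) → A ∈ ℝ`. -/
def CondA2 (l g : ℝ → ℝ) (K γ A : ℝ) (b : ℝ → ℝ) (k : ℕ → ℕ) : Prop :=
  SecondOrderRV l g K γ ∧
    Tendsto (fun n : ℕ => Real.sqrt (k n) * g (b ((n : ℝ) / k n))) atTop (nhds A)

/-- covariance of two real random variables -/
def cov (f g : Ω → ℝ) : ℝ :=
  ∫ ω, (f ω - ∫ ω', f ω') * (g ω - ∫ ω', g ω')

/-- pairs `1 ≤ i < j ≤ N` -/
def pairsUpTo (N : ℕ) : Finset (ℕ × ℕ) :=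
  ((Finset.Icc 1 N) ×ˢ (Finset.Icc 1 N)).filter fun p => p.1 < p.2

/-- Condition (A3): existence of the limits `χ` and `ω` of the normalized sums of
covariances, for every `0 < ε < 1`. -/
def CondA3 (X : ℕ → Ω → ℝ) (b : ℝ → ℝ) (k r : ℕ → ℕ) (α χ ωc : ℝ) : Prop :=
  0 ≤ χ ∧ 0 ≤ ωc ∧
  ∀ ε : ℝ, 0 < ε → ε < 1 →
    (Tendsto (fun n : ℕ =>
        (2 * α ^ 2 * n / ((⌊ε * r n⌋₊ : ℝ) * k n)) *
          ∑ p ∈ pairsUpTo ⌊ε * r n⌋₊,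
            cov (fun ω => pos (Real.log (X p.1 ω) - Real.log (b ((n : ℝ) / k n))))
                (fun ω => pos (Real.log (X p.2 ω) - Real.log (b ((n : ℝ) / k n)))))
      atTop (nhds χ)) ∧
    (Tendsto (fun n : ℕ =>
        (2 * (n : ℝ) / ((⌊ε * r n⌋₊ : ℝ) * k n)) *
          ∑ p ∈ pairsUpTo ⌊ε * r n⌋₊,
            cov (fun ω => if b ((n : ℝ) / k n) < X p.1 ω then (1 : ℝ) else 0)
                (fun ω => if b ((n : ℝ) / k n) < X p.2 ω then (1 : ℝ) else 0))
      atTop (nhds ωc))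

/-- the `k`-th largest value among `X_1, …, X_n` -/
def orderStat (n k : ℕ) (X : ℕ → Ω → ℝ) (ω : Ω) : ℝ :=
  sInf {x : ℝ | ((Finset.Icc 1 n).filter fun i => x < X i ω).card < k}

/-- `|Σ_{i=1}^l Y_i - (l/n) Σ_{i=1}^n Y_i|` -/
def cusumAt (n : ℕ) (Y : ℕ → ℝ) (l : ℕ) : ℝ :=
  |∑ i ∈ Finset.Icc 1 l, Y i - ((l : ℝ) / n) * ∑ i ∈ Finset.Icc 1 n, Y i|

/-- The cusum statistic `T_n(φ)` with random threshold `X_(k)`. -/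
def cusum (n k : ℕ) (X : ℕ → Ω → ℝ) (φ : ℝ → ℝ) (ω : Ω) : ℝ :=
  (Real.sqrt k)⁻¹ *
    ⨆ l ∈ Finset.Icc 1 n,
      cusumAt n (fun i => φ (Real.log (X i ω) - Real.log (orderStat n k X ω))) l

/-- The cusum statistic with deterministic threshold `b(n/k)`. -/
def cusumDet (n k : ℕ) (X : ℕ → Ω → ℝ) (φ : ℝ → ℝ) (b : ℝ → ℝ) (ω : Ω) : ℝ :=
  (Real.sqrt k)⁻¹ *
    ⨆ l ∈ Finset.Icc 1 n,
      cusumAt n (fun i => φ (Real.log (X i ω) - Real.log (b ((n : ℝ) / k)))) l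

/-- convergence in distribution (weak convergence of laws) of real random variables to
a real random variable `Z` defined on a possibly different probability space -/
def TendstoInDist {Ω' : Type*} [MeasureSpace Ω'] (Y : ℕ → Ω → ℝ) (Z : Ω' → ℝ) : Prop :=
  ∀ f : ℝ → ℝ, Continuous f → (∃ C, ∀ x, |f x| ≤ C) →
    Tendsto (fun n : ℕ => ∫ ω, f (Y n ω)) atTop (nhds (∫ ω, f (Z ω)))

/-- convergence in distribution to a law `μ` on `ℝ` -/
def TendstoInLaw (Y : ℕ → Ω → ℝ) (μ : Measure ℝ) : Prop :=
  ∀ f : ℝ → ℝ, Continuous f → (∃ C, ∀ x, |f x| ≤ C) →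
    Tendsto (fun n : ℕ => ∫ ω, f (Y n ω)) atTop (nhds (∫ x, f x ∂μ))

/-- bounded in probability (`O_P(1)`) -/
def BddInProb (Y : ℕ → Ω → ℝ) : Prop :=
  ∀ ε : ℝ, 0 < ε → ∃ C : ℝ, ∀ᶠ n in atTop,
    ((ℙ : Measure Ω) {ω | C < |Y n ω|}).toReal < ε

/-- divergence to `+∞` in probability -/
def DivergesInProb (Y : ℕ → Ω → ℝ) : Prop :=
  ∀ C : ℝ, Tendsto (fun n : ℕ => ((ℙ : Measure Ω) {ω | Y n ω ≤ C}).toReal) atTop (nhds 0)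

/-- standard Brownian motion on `[0, ∞)` -/
structure IsStdBrownianMotion {Ω' : Type*} [MeasureSpace Ω'] (B : ℝ → Ω' → ℝ) : Prop where
  isProb : IsProbabilityMeasure (ℙ : Measure Ω')
  meas : ∀ t, Measurable (B t)
  start : ∀ᵐ ω ∂(ℙ : Measure Ω'), B 0 ω = 0
  gauss_incr : ∀ s t : ℝ, 0 ≤ s → s ≤ t →
    Measure.map (fun ω => B t ω - B s ω) (ℙ : Measure Ω')
      = gaussianReal 0 (Real.toNNReal (t - s))
  indep_incr : ∀ (n : ℕ) (ts : ℕ → ℝ), (∀ i, 0 ≤ ts i) → Monotone ts →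
    iIndepFun (m := fun _ => Real.measurableSpace)
      (fun i : Fin n => fun ω => B (ts ((i : ℕ) + 1)) ω - B (ts (i : ℕ)) ω)
      (ℙ : Measure Ω')

/-- `sup_{0 ≤ t ≤ 1} |B°(t)|` where `B°(t) = B(t) - t B(1)` is the Brownian bridge
associated with the Brownian motion `B` -/
def supAbsBrownianBridge {Ω' : Type*} [MeasureSpace Ω'] (B : ℝ → Ω' → ℝ) (ω : Ω') : ℝ :=
  ⨆ t : Icc (0 : ℝ) 1, |B (t : ℝ) ω - (t : ℝ) * B 1 ω|

/-- `A_i(ζ) = φ(log X_i - log b(n/k) + ζ/√k)` -/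
def An (X : ℕ → Ω → ℝ) (b : ℝ → ℝ) (φ : ℝ → ℝ) (n k : ℕ) (ζ : ℝ) (i : ℕ) (ω : Ω) : ℝ :=
  φ (Real.log (X i ω) - Real.log (b ((n : ℝ) / k)) + ζ / Real.sqrt k)

/-- the tail sequential process `M_n(t, ζ) = k^{-1/2} Σ_{i=1}^{[nt]} (A_i(ζ) - E A_1(ζ))` -/
def Mn (X : ℕ → Ω → ℝ) (b : ℝ → ℝ) (φ : ℝ → ℝ) (n k : ℕ) (t ζ : ℝ) (ω : Ω) : ℝ :=
  (Real.sqrt k)⁻¹ * ∑ i ∈ Finset.Icc 1 ⌊(n : ℝ) * t⌋₊,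
    (An X b φ n k ζ i ω - ∫ ω', An X b φ n k ζ 1 ω')

/-- residual `ξ̂_i = X_i - Σ_{j=1}^p φ̂_j X_{i-j}` of an AR(p) fit -/
def residual (p : ℕ) (X : ℤ → Ω → ℝ) (φh : Ω → Fin p → ℝ) (i : ℕ) (ω : Ω) : ℝ :=
  X i ω - ∑ j : Fin p, φh ω j * X ((i : ℤ) - ((j : ℕ) + 1)) ω

/-- absolute residual `Ẑ_i = |ξ̂_i|` -/
def Zhat (p : ℕ) (X : ℤ → Ω → ℝ) (φh : Ω → Fin p → ℝ) (i : ℕ) (ω : Ω) : ℝ :=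
  |residual p X φh i ω|

/-- stationarity of the restriction of `Y` to the segment of indices `[a, b]` -/
def SegStationary (a b : ℕ) (Y : ℕ → Ω → ℝ) : Prop :=
  ∀ (m : ℕ) (s : Fin m → ℕ) (j : ℕ), (∀ q, a ≤ s q ∧ s q + j ≤ b) →
    Measure.map (fun ω => fun q : Fin m => Y (s q + j) ω) (ℙ : Measure Ω)
      = Measure.map (fun ω => fun q : Fin m => Y (s q) ω) (ℙ : Measure Ω)

/-- the row-wise mixing coefficient
`β_n(l) = sup_m sup {|P(A∩B) - P(A)P(B)| : A ∈ σ(Y_i : m+l+1 ≤ i ≤ n), B ∈ σ(Y_1,…,Y_m)}` -/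
def betaMixRow (n : ℕ) (Y : ℕ → Ω → ℝ) (lag : ℕ) : ℝ :=
  ⨆ m : ℕ, ⨆ As : Subtype (MeasurableSet : Set (Fin (n - (m + lag)) → ℝ) → Prop),
    ⨆ Bs : Subtype (MeasurableSet : Set (Fin m → ℝ) → Prop),
      |((ℙ : Measure Ω)
          (((fun ω => fun i : Fin (n - (m + lag)) => Y (m + lag + 1 + (i : ℕ)) ω) ⁻¹' As.1)
            ∩ ((fun ω => fun i : Fin m => Y ((i : ℕ) + 1) ω) ⁻¹' Bs.1))).toReal
        - ((ℙ : Measure Ω)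
            ((fun ω => fun i : Fin (n - (m + lag)) => Y (m + lag + 1 + (i : ℕ)) ω) ⁻¹' As.1)).toReal
          * ((ℙ : Measure Ω)
            ((fun ω => fun i : Fin m => Y ((i : ℕ) + 1) ω) ⁻¹' Bs.1)).toReal|

/-- Two sequences of measurable functions with the same continuous pointwise limit are close to it
at points of `[0, 1]` that differ by a prescribed vanishing shift. -/
lemma eventually_exists_shifted_points {f h : ℕ → ℝ → ℝ} {φ : ℝ → ℝ}
    (hf : ∀ n, Measurable (f n)) (hh : ∀ n, Measurable (h n)) (hφ : Continuous φ)
    (hfφ : ∀ v, Tendsto (fun n => f n v) atTop (nhds (φ v)))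
    (hhφ : ∀ v, Tendsto (fun n => h n v) atTop (nhds (φ v)))
    {u : ℕ → ℝ} (hu : Tendsto u atTop (nhds 0)) {ε : ℝ} (hε : 0 < ε) :
    ∀ᶠ n in atTop, ∃ v ∈ Icc (0 : ℝ) 1, |f n (v + u n) - φ v| < ε ∧ |h n v - φ v| < ε := by
  have key : ∀ F : ℕ → ℝ → ℝ, (∀ n, Measurable (F n)) →
      (∀ v, Tendsto (fun n => F n v) atTop (nhds (φ v))) →
      ∀ᶠ n in atTop, volume ({v | ε / 2 ≤ |F n v - φ v|} ∩ Icc (-1 : ℝ) 2)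
        < ENNReal.ofReal (1 / 2) := by
    intro F hF hFφ
    have hm := tendstoInMeasure_of_tendsto_ae (μ := volume.restrict (Icc (-1 : ℝ) 2))
      (fun n => (hF n).aestronglyMeasurable) (Eventually.of_forall hFφ)
    rw [tendstoInMeasure_iff_norm] at hm
    have hlim := hm (ε / 2) (half_pos hε)
    filter_upwards [hlim.eventually_lt_const
      (ENNReal.ofReal_pos.2 (by norm_num : (0 : ℝ) < 1 / 2))] with n hn
    rwa [Measure.restrict_apply' measurableSet_Icc] at hn
  have huc : UniformContinuousOn φ (Icc (-1 : ℝ) 2) :=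
    isCompact_Icc.uniformContinuousOn_of_continuous hφ.continuousOn
  obtain ⟨δ, hδ, hδφ⟩ := Metric.uniformContinuousOn_iff.1 huc (ε / 2) (half_pos hε)
  have hu_small : ∀ᶠ n in atTop, |u n| < min δ 1 := by
    have := Metric.tendsto_nhds.1 hu (min δ 1) (lt_min hδ one_pos)
    simpa [Real.dist_eq] using this
  filter_upwards [key f hf hfφ, key h hh hhφ, hu_small] with n hfn hhn hun
  by_contra! hcon
  have hu1 : |u n| < 1 := hun.trans_le (min_le_right _ _)
  rw [abs_lt] at hu1
  have hsub : Icc (0 : ℝ) 1 ⊆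
      (fun v => v + u n) ⁻¹' ({v | ε / 2 ≤ |f n v - φ v|} ∩ Icc (-1 : ℝ) 2)
        ∪ ({v | ε / 2 ≤ |h n v - φ v|} ∩ Icc (-1 : ℝ) 2) := by
    intro v hv
    have hvI : v ∈ Icc (-1 : ℝ) 2 := ⟨by linarith [hv.1], by linarith [hv.2]⟩
    have hvuI : v + u n ∈ Icc (-1 : ℝ) 2 := ⟨by linarith [hv.1], by linarith [hv.2]⟩
    by_cases hbad : ε / 2 ≤ |f n (v + u n) - φ (v + u n)|
    · exact Or.inl ⟨hbad, hvuI⟩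
    · refine Or.inr ⟨?_, hvI⟩
      have hφv : |φ (v + u n) - φ v| < ε / 2 := by
        have := hδφ (v + u n) hvuI v hvI
          (by simpa [Real.dist_eq] using hun.trans_le (min_le_left _ _))
        rwa [Real.dist_eq] at this
      have hclose : |f n (v + u n) - φ v| < ε := by
        have := abs_sub_le (f n (v + u n)) (φ (v + u n)) (φ v)
        linarith [not_le.1 hbad]
      exact (half_le_self hε.le).trans (hcon v hv hclose)
  have hvol := (measure_mono hsub).trans (measure_union_le (μ := volume) _ _)
  rw [measure_preimage_add_right, Real.volume_Icc] at hvol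
  have hlt := hvol.trans_lt (ENNReal.add_lt_add hfn hhn)
  rw [← ENNReal.ofReal_add (by norm_num) (by norm_num)] at hlt
  norm_num at hlt

/-- The ratio of a positive regularly varying function at asymptotically equivalent arguments
tends to one. -/
lemma RegularlyVarying.tendsto_ratio {g : ℝ → ℝ} {ρ : ℝ} (hg : RegularlyVarying g ρ)
    (hpos : ∀ x, 0 < x → 0 < g x) :
    Tendsto (fun p : ℝ × ℝ => g (Real.exp (p.1 + p.2)) / g (Real.exp p.1))
      (atTop ×ˢ nhds 0) (nhds 1) := by
  have hmeas : Measurable fun x => g (Real.exp x) := hg.1.comp Real.measurable_exp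
  have hG : ∀ x, 0 < g (Real.exp x) := fun x => hpos _ (Real.exp_pos x)
  have hlog : ∀ v, Tendsto (fun x => Real.log (g (Real.exp (x + v))) - Real.log (g (Real.exp x)))
      atTop (nhds (ρ * v)) := by
    intro v
    have h1 := ((hg.2 (Real.exp v) (Real.exp_pos v)).comp Real.tendsto_exp_atTop).log
      (Real.rpow_pos_of_pos (Real.exp_pos v) ρ).ne'
    rw [Real.log_rpow (Real.exp_pos v), Real.log_exp] at h1
    refine h1.congr fun x => ?_
    simp only [Function.comp_apply]
    rw [← Real.exp_add, add_comm v x, Real.log_div (hG _).ne' (hG _).ne']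
  have hzero : Tendsto (fun p : ℝ × ℝ =>
      Real.log (g (Real.exp (p.1 + p.2))) - Real.log (g (Real.exp p.1)))
      (atTop ×ˢ nhds 0) (nhds 0) := by
    refine tendsto_of_seq_tendsto fun p hp => ?_
    have hx : Tendsto (fun n => (p n).1) atTop atTop := tendsto_fst.comp hp
    have hu : Tendsto (fun n => (p n).2) atTop (nhds 0) := tendsto_snd.comp hp
    rw [Metric.tendsto_nhds]
    intro ε hε
    have hpts := eventually_exists_shifted_points (φ := fun v => ρ * v)
      (f := fun n v => Real.log (g (Real.exp ((p n).1 + v))) - Real.log (g (Real.exp (p n).1)))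
      (h := fun n v => Real.log (g (Real.exp ((p n).1 + (p n).2 + v)))
        - Real.log (g (Real.exp ((p n).1 + (p n).2))))
      (fun n => ((hmeas.comp (measurable_const_add _)).log).sub_const _)
      (fun n => ((hmeas.comp (measurable_const_add _)).log).sub_const _)
      (by fun_prop) (fun v => (hlog v).comp hx) (fun v => (hlog v).comp (hx.atTop_add hu))
      hu (half_pos hε)
    filter_upwards [hpts] with n hn
    obtain ⟨v, -, hv1, hv2⟩ := hn
    rw [Real.dist_eq, sub_zero, Function.comp_apply]
    rw [show (p n).1 + (v + (p n).2) = (p n).1 + (p n).2 + v by ring] at hv1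
    rw [abs_lt] at hv1 hv2 ⊢
    constructor <;> linarith [hv1.1, hv1.2, hv2.1, hv2.2]
  have hexp := (Real.continuous_exp.tendsto 0).comp hzero
  rw [Real.exp_zero] at hexp
  refine hexp.congr fun p => ?_
  simp only [Function.comp_apply]
  rw [Real.exp_sub, Real.exp_log (hG _), Real.exp_log (hG _)]

lemma SlowlyVarying.regularlyVarying {l : ℝ → ℝ} (hl : SlowlyVarying l) :
    RegularlyVarying l 0 :=
  ⟨hl.1, fun lam hlam => by simpa using hl.2 lam hlam⟩

lemma continuous_kappaFun_exp (K γ : ℝ) : Continuous fun v => kappaFun K γ (Real.exp v) := by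
  have hcont : ∀ x : ℝ, 0 < x → ContinuousAt (fun x => ∫ t in (1 : ℝ)..x, t ^ (γ - 1)) x := by
    intro x hx
    refine (intervalIntegral.integral_hasDerivAt_right ?_ ?_ ?_).continuousAt
    · refine intervalIntegral.intervalIntegrable_rpow (Or.inr fun h0 => ?_)
      exact absurd h0.1 (not_le.2 (lt_min one_pos hx))
    · exact (measurable_id.pow_const (γ - 1)).stronglyMeasurable.stronglyMeasurableAtFilter
    · exact Real.continuousAt_rpow_const x (γ - 1) (Or.inl hx.ne')
  refine continuous_iff_continuousAt.2 fun v => ?_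
  exact continuousAt_const.mul
    (ContinuousAt.comp (f := Real.exp) (hcont (Real.exp v) (Real.exp_pos v))
      Real.continuous_exp.continuousAt)

/-- Second-order regular variation holds uniformly near `λ = 1`. -/
lemma SecondOrderRV.tendsto_near_one {l g : ℝ → ℝ} {K γ : ℝ} (h : SecondOrderRV l g K γ)
    (hl : SlowlyVarying l) (hlpos : ∀ x, 0 < x → 0 < l x) :
    Tendsto (fun p : ℝ × ℝ =>
        (l (Real.exp (p.1 + p.2)) / l (Real.exp p.1) - 1) / g (Real.exp p.1))
      (atTop ×ˢ nhds 0) (nhds 0) := by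
  obtain ⟨-, hgpos, hg, hlim⟩ := h
  have hL : ∀ x, 0 < l (Real.exp x) := fun x => hlpos _ (Real.exp_pos x)
  have hlmeas : Measurable fun x => l (Real.exp x) := hl.1.comp Real.measurable_exp
  have hRlim : ∀ v, Tendsto
      (fun x => (l (Real.exp (x + v)) / l (Real.exp x) - 1) / g (Real.exp x))
      atTop (nhds (kappaFun K γ (Real.exp v))) := by
    intro v
    refine ((hlim (Real.exp v) (Real.exp_pos v)).comp Real.tendsto_exp_atTop).congr fun x => ?_
    simp only [Function.comp_apply]
    rw [← Real.exp_add, add_comm v x]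
  have hcont := continuous_kappaFun_exp K γ
  obtain ⟨B, hB⟩ := (isCompact_Icc (a := (0 : ℝ)) (b := 1)).exists_bound_of_continuousOn
    hcont.continuousOn
  have hB0 : 0 ≤ B := (norm_nonneg _).trans (hB 0 (by norm_num))
  refine tendsto_of_seq_tendsto fun p hp => ?_
  have hx : Tendsto (fun n => (p n).1) atTop atTop := tendsto_fst.comp hp
  have hu : Tendsto (fun n => (p n).2) atTop (nhds 0) := tendsto_snd.comp hp
  have hc := ((hg.tendsto_ratio fun x _ => hgpos x).mul
    (hl.regularlyVarying.tendsto_ratio hlpos)).comp hp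
  rw [mul_one] at hc
  rw [Metric.tendsto_nhds]
  intro ε hε
  set η : ℝ := min 1 (ε / (B + 4)) with hη
  have hη0 : 0 < η := lt_min one_pos (div_pos hε (by linarith))
  have hηε : η * (B + 4) ≤ ε := by
    calc η * (B + 4) ≤ ε / (B + 4) * (B + 4) :=
          mul_le_mul_of_nonneg_right (min_le_right _ _) (by linarith)
      _ = ε := div_mul_cancel₀ _ (by linarith)
  have hη1 : η ≤ 1 := min_le_left _ _
  have hpts := eventually_exists_shifted_points (φ := fun v => kappaFun K γ (Real.exp v))
    (f := fun n v => (l (Real.exp ((p n).1 + v)) / l (Real.exp (p n).1) - 1)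
      / g (Real.exp (p n).1))
    (h := fun n v => (l (Real.exp ((p n).1 + (p n).2 + v)) / l (Real.exp ((p n).1 + (p n).2)) - 1)
      / g (Real.exp ((p n).1 + (p n).2)))
    (fun n => (((hlmeas.comp (measurable_const_add _)).div_const _).sub_const _).div_const _)
    (fun n => (((hlmeas.comp (measurable_const_add _)).div_const _).sub_const _).div_const _)
    hcont (fun v => (hRlim v).comp hx) (fun v => (hRlim v).comp (hx.atTop_add hu)) hu hη0
  filter_upwards [hpts, Metric.tendsto_nhds.1 hc η hη0] with n ⟨v, hv, hv1, hv2⟩ hcn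
  rw [Real.dist_eq, sub_zero, Function.comp_apply]
  rw [Real.dist_eq, Function.comp_apply] at hcn
  rw [show (p n).1 + (v + (p n).2) = (p n).1 + (p n).2 + v by ring] at hv1
  have hκ := hB v hv
  rw [Real.norm_eq_abs] at hκ
  set x := (p n).1
  set y := x + (p n).2
  set c := g (Real.exp y) / g (Real.exp x) * (l (Real.exp y) / l (Real.exp x)) with hcdef
  set R₁ := (l (Real.exp (y + v)) / l (Real.exp x) - 1) / g (Real.exp x) with hR₁
  set R₂ := (l (Real.exp (y + v)) / l (Real.exp y) - 1) / g (Real.exp y) with hR₂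
  set q := kappaFun K γ (Real.exp v)
  have hcocycle : (l (Real.exp y) / l (Real.exp x) - 1) / g (Real.exp x) = R₁ - R₂ * c := by
    have h1 := (hL x).ne'
    have h2 := (hL y).ne'
    have h3 := (hgpos (Real.exp x)).ne'
    have h4 := (hgpos (Real.exp y)).ne'
    rw [hR₁, hR₂, hcdef]
    field_simp
    ring
  rw [hcocycle, show R₁ - R₂ * c = (R₁ - q) - (R₂ - q) - (R₂ - q) * (c - 1) - q * (c - 1) by ring]
  have hb1 : |(R₂ - q) * (c - 1)| ≤ η * 1 := by
    rw [abs_mul]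
    exact mul_le_mul hv2.le (hcn.le.trans hη1) (abs_nonneg _) hη0.le
  have hb2 : |q * (c - 1)| ≤ B * η := by
    rw [abs_mul]
    exact mul_le_mul hκ hcn.le (abs_nonneg _) hB0
  have hfin : |R₁ - q - (R₂ - q) - (R₂ - q) * (c - 1) - q * (c - 1)|
      ≤ |R₁ - q| + |R₂ - q| + |(R₂ - q) * (c - 1)| + |q * (c - 1)| :=
    (abs_sub _ _).trans (add_le_add_left ((abs_sub _ _).trans
      (add_le_add_left (abs_sub _ _) _)) _)
  nlinarith

lemma tailDF_antitone (μ : Measure ℝ) [IsFiniteMeasure μ] : Antitone (tailDF μ) :=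
  fun _ _ hxy => measureReal_mono (Ioi_subset_Ioi hxy)

lemma df_eq_one_sub_tailDF (μ : Measure ℝ) [IsProbabilityMeasure μ] (x : ℝ) :
    df μ x = 1 - tailDF μ x := by
  have h := probReal_compl_eq_one_sub (μ := μ) (measurableSet_Ioi (a := x))
  rwa [compl_Ioi] at h

lemma ParetoTail.tailDF_pos {μ : Measure ℝ} [IsFiniteMeasure μ] {α : ℝ} {l : ℝ → ℝ}
    (hF : ParetoTail μ α l) (x : ℝ) : 0 < tailDF μ x := by
  by_contra! hx
  have hl : ∀ᶠ y in atTop, l (1 * y) / l y = 0 := by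
    filter_upwards [eventually_ge_atTop x, eventually_gt_atTop 0] with y hxy hy
    have h0 : tailDF μ y = 0 :=
      le_antisymm ((tailDF_antitone μ hxy).trans hx) ENNReal.toReal_nonneg
    rw [hF.2 y hy, mul_eq_zero] at h0
    rw [h0.resolve_left (Real.rpow_pos_of_pos hy _).ne', div_zero]
  exact zero_ne_one (tendsto_nhds_unique
    (tendsto_const_nhds.congr' (hl.mono fun _ h => h.symm)) (hF.1.2 1 one_pos))

lemma ParetoTail.slowlyVarying_pos {μ : Measure ℝ} [IsFiniteMeasure μ] {α : ℝ} {l : ℝ → ℝ}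
    (hF : ParetoTail μ α l) (x : ℝ) (hx : 0 < x) : 0 < l x := by
  have h := hF.tailDF_pos x
  rw [hF.2 x hx] at h
  exact pos_of_mul_pos_right h (Real.rpow_nonneg hx.le _)

lemma lt_of_mem_quantile_set {μ : Measure ℝ} [IsProbabilityMeasure μ] {x y z : ℝ}
    (hx : x⁻¹ < tailDF μ y) (hz : 1 - x⁻¹ ≤ df μ z) : y < z := by
  by_contra! hzy
  rw [df_eq_one_sub_tailDF] at hz
  linarith [tailDF_antitone μ hzy]

lemma quantile_set_nonempty (μ : Measure ℝ) [IsProbabilityMeasure μ] {x : ℝ} (hx : 0 < x) :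
    {y : ℝ | 1 - x⁻¹ ≤ df μ y}.Nonempty := by
  have h := (tendsto_cdf_atTop μ).eventually_const_le
    (show 1 - x⁻¹ < 1 by linarith [inv_pos.2 hx])
  obtain ⟨y, hy⟩ := h.exists
  rw [cdf_eq_real] at hy
  exact ⟨y, hy⟩

lemma tendsto_quantileB_atTop {μ : Measure ℝ} [IsProbabilityMeasure μ]
    (hμ : ∀ x, 0 < tailDF μ x) : Tendsto (quantileB μ) atTop atTop := by
  refine tendsto_atTop.2 fun y => ?_
  filter_upwards [tendsto_inv_atTop_zero.eventually_lt_const (hμ y), eventually_gt_atTop 0]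
    with x hxy hx
  exact le_csInf (quantile_set_nonempty μ hx) fun z hz => (lt_of_mem_quantile_set hxy hz).le

lemma tailDF_le_inv_of_quantileB_lt {μ : Measure ℝ} [IsProbabilityMeasure μ] {x y : ℝ}
    (hx : 0 < x) (hy : quantileB μ x < y) : tailDF μ y ≤ x⁻¹ := by
  obtain ⟨z, hz, hzy⟩ := exists_lt_of_csInf_lt (quantile_set_nonempty μ hx) hy
  rw [mem_ofPred_eq, df_eq_one_sub_tailDF] at hz
  linarith [tailDF_antitone μ hzy.le]

lemma inv_le_tailDF_of_lt_quantileB {μ : Measure ℝ} [IsProbabilityMeasure μ] {x y w : ℝ}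
    (hw : x⁻¹ < tailDF μ w) (hy : y < quantileB μ x) : x⁻¹ ≤ tailDF μ y := by
  have h := notMem_of_lt_csInf hy ⟨w, fun z hz => (lt_of_mem_quantile_set hw hz).le⟩
  rw [mem_ofPred_eq, df_eq_one_sub_tailDF, not_le] at h
  linarith

/-- First-order expansion of the tail relative to its value along a sequence `e ^ x n → ∞`, with
an error that is uniformly of smaller order than `1 / s n`. -/
lemma ParetoTail.relative_expansion {μ : Measure ℝ} [IsFiniteMeasure μ] {α : ℝ} {l g : ℝ → ℝ}
    {K γ A : ℝ} (hF : ParetoTail μ α l) (h2 : SecondOrderRV l g K γ) {x s : ℕ → ℝ}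
    (hx : Tendsto x atTop atTop) (hs : Tendsto s atTop atTop)
    (hA : Tendsto (fun n => s n * g (Real.exp (x n))) atTop (nhds A)) (M : ℝ) {ε : ℝ}
    (hε : 0 < ε) :
    ∀ᶠ n in atTop, ∀ ζ : ℝ, |ζ| ≤ M →
      s n * |tailDF μ (Real.exp (x n + ζ / s n)) / tailDF μ (Real.exp (x n)) - 1 + α * (ζ / s n)|
        ≤ ε := by
  have hR := Metric.tendsto_nhds.1 (h2.tendsto_near_one hF.1 hF.slowlyVarying_pos)
  set D : ℝ := Real.exp 1 * (|A| + 1) with hD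
  have hD0 : 0 < D := mul_pos (Real.exp_pos 1) (by positivity)
  have hR' := (hR (ε / (2 * D)) (by positivity))
  obtain ⟨P, hP, Q, hQ, hPQ⟩ := eventually_prod_iff.1 hR'
  obtain ⟨δ, hδ, hδQ⟩ := Metric.eventually_nhds_iff.1 hQ
  have hsmall : ∀ r : ℝ, Tendsto (fun n => r / s n) atTop (nhds 0) :=
    fun r => hs.const_div_atTop r
  filter_upwards [hx.eventually hP, hs.eventually_gt_atTop 0,
    (hsmall M).eventually_lt_const hδ, (hsmall (|α| * M)).eventually_lt_const one_pos,
    (hsmall ((α * M) ^ 2)).eventually_lt_const (half_pos hε),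
    hA.abs.eventually_lt_const (lt_add_one |A|)] with n hPn hsn hMδ hαM hαM2 hAn ζ hζ
  set u : ℝ := ζ / s n with hu
  have hu_abs : |u| ≤ M / s n := by
    rw [hu, abs_div, abs_of_pos hsn]
    exact div_le_div_of_nonneg_right hζ hsn.le
  have hRu := hPQ hPn (hδQ (show dist u 0 < δ by
    rw [Real.dist_eq, sub_zero]; exact hu_abs.trans_lt hMδ))
  rw [Real.dist_eq, sub_zero] at hRu
  set R := (l (Real.exp (x n + u)) / l (Real.exp (x n)) - 1) / g (Real.exp (x n)) with hRdef
  have hgp := h2.2.1 (Real.exp (x n))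
  have hlp := hF.slowlyVarying_pos _ (Real.exp_pos (x n))
  have hratio : tailDF μ (Real.exp (x n + u)) / tailDF μ (Real.exp (x n))
      = Real.exp (-α * u) * (1 + g (Real.exp (x n)) * R) := by
    rw [hF.2 _ (Real.exp_pos _), hF.2 _ (Real.exp_pos _), ← Real.exp_mul, ← Real.exp_mul,
      mul_div_mul_comm, ← Real.exp_sub, hRdef, mul_div_cancel₀ _ hgp.ne']
    congr 1
    · congr 1; ring
    · ring
  have hαu : |-α * u| ≤ |α| * M / s n := by
    rw [abs_mul, abs_neg, mul_div_assoc]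
    exact mul_le_mul_of_nonneg_left hu_abs (abs_nonneg _)
  have hexp1 := Real.abs_exp_sub_one_sub_id_le (hαu.trans hαM.le)
  have hexp2 : Real.exp (-α * u) ≤ Real.exp 1 :=
    Real.exp_le_exp.2 ((le_abs_self _).trans (hαu.trans hαM.le))
  have hfirst : s n * |Real.exp (-α * u) - 1 - -α * u| ≤ ε / 2 := by
    have hsq : (-α * u) ^ 2 ≤ (|α| * M / s n) ^ 2 := sq_le_sq' (by linarith [neg_abs_le (-α * u)])
      ((le_abs_self _).trans hαu)
    calc s n * |Real.exp (-α * u) - 1 - -α * u| ≤ s n * (|α| * M / s n) ^ 2 :=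
          mul_le_mul_of_nonneg_left (hexp1.trans hsq) hsn.le
      _ = (α * M) ^ 2 / s n := by
          rw [div_pow, mul_pow, sq_abs, mul_pow]
          field_simp
      _ ≤ ε / 2 := hαM2.le
  have hsecond : s n * |Real.exp (-α * u) * (g (Real.exp (x n)) * R)| ≤ ε / 2 := by
    rw [abs_of_pos (mul_pos hsn hgp)] at hAn
    calc s n * |Real.exp (-α * u) * (g (Real.exp (x n)) * R)|
        = Real.exp (-α * u) * (s n * g (Real.exp (x n))) * |R| := by
          rw [abs_mul, abs_mul, abs_of_pos hgp, abs_of_pos (Real.exp_pos _)]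
          ring
      _ ≤ D * (ε / (2 * D)) := by
          refine mul_le_mul ?_ hRu.le (abs_nonneg _) hD0.le
          exact mul_le_mul hexp2 hAn.le (mul_pos hsn hgp).le (Real.exp_pos 1).le
      _ = ε / 2 := by field_simp
  rw [hratio, show Real.exp (-α * u) * (1 + g (Real.exp (x n)) * R) - 1 + α * u
    = (Real.exp (-α * u) - 1 - -α * u) + Real.exp (-α * u) * (g (Real.exp (x n)) * R) by ring]
  have := mul_le_mul_of_nonneg_left (abs_add_le (Real.exp (-α * u) - 1 - -α * u)
    (Real.exp (-α * u) * (g (Real.exp (x n)) * R))) hsn.le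
  linarith

/-- Lemma 2, first part, of Kim–Lee (2009):
`F̄(e^{ζ/√k} b(n/k)) = (k/n)(1 - αζ/√k + o(1/√k))` uniformly on compact `ζ`-sets. -/
theorem tail_expansion_uniform
    {Ω : Type*} [MeasureSpace Ω] [IsProbabilityMeasure (ℙ : Measure Ω)]
    (X : Ω → ℝ) (hmeas : Measurable X) (hpos : ∀ ω, 0 ≤ X ω)
    (α : ℝ) (hα : 0 < α) (l : ℝ → ℝ)
    (hF : ParetoTail (Measure.map X (ℙ : Measure Ω)) α l)
    (k : ℕ → ℕ) (hk : TailFraction k)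
    (g : ℝ → ℝ) (K γ A : ℝ)
    (hA2 : CondA2 l g K γ A (quantileB (Measure.map X (ℙ : Measure Ω))) k) :
    ∀ C : Set ℝ, IsCompact C →
      Tendsto (fun n : ℕ =>
          ⨆ ζ : C, Real.sqrt (k n) *
            |((n : ℝ) / k n) * tailDF (Measure.map X (ℙ : Measure Ω))
                (Real.exp ((ζ : ℝ) / Real.sqrt (k n)) *
                  quantileB (Measure.map X (ℙ : Measure Ω)) ((n : ℝ) / k n))
              - 1 + α * (ζ : ℝ) / Real.sqrt (k n)|)
        atTop (nhds 0) := by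
  intro C hC
  set μ : Measure ℝ := Measure.map X (ℙ : Measure Ω) with hμdef
  have hμ : IsProbabilityMeasure μ := Measure.isProbabilityMeasure_map hmeas.aemeasurable
  have hFpos := hF.tailDF_pos
  obtain ⟨M, hM0, hM⟩ := hC.isBounded.exists_pos_norm_le
  have hs : Tendsto (fun n => Real.sqrt (k n)) atTop atTop :=
    Real.tendsto_sqrt_atTop.comp hk.1
  have hy : Tendsto (fun n : ℕ => (n : ℝ) / k n) atTop atTop := by
    have hpos : ∀ᶠ n : ℕ in atTop, (0 : ℝ) < (k n : ℝ) / n := by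
      filter_upwards [hk.1.eventually_gt_atTop 0, eventually_gt_atTop 0] with n hkn hn
      exact div_pos hkn (Nat.cast_pos.2 hn)
    refine (tendsto_inv_nhdsGT_zero.comp
      (tendsto_nhdsWithin_iff.2 ⟨hk.2, hpos⟩)).congr fun n => ?_
    simp only [Function.comp_apply, inv_div]
  have hb : Tendsto (fun n : ℕ => quantileB μ ((n : ℝ) / k n)) atTop atTop :=
    (tendsto_quantileB_atTop hFpos).comp hy
  have hx := Real.tendsto_log_atTop.comp hb
  have hexp : ∀ᶠ n : ℕ in atTop, Real.exp (Real.log (quantileB μ ((n : ℝ) / k n)))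
      = quantileB μ ((n : ℝ) / k n) := by
    filter_upwards [hb.eventually_gt_atTop 0] with n hn using Real.exp_log hn
  have hA : Tendsto (fun n : ℕ => Real.sqrt (k n) *
      g (Real.exp (Real.log (quantileB μ ((n : ℝ) / k n))))) atTop (nhds A) :=
    hA2.2.congr' (hexp.mono fun n hn => by simp only [hn])
  have hexpand := fun (M : ℝ) {ε : ℝ} (hε : 0 < ε) =>
    hF.relative_expansion hA2.1 hx hs hA M hε
  refine Metric.tendsto_nhds.2 fun ε hε => ?_
  set η : ℝ := ε / 32 with hη
  have hη0 : 0 < η := by positivity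
  set d : ℝ := η / α with hd
  have hd0 : 0 < d := div_pos hη0 hα
  have hαd : α * d = η := mul_div_cancel₀ _ hα.ne'
  filter_upwards [hexpand M hη0, hexpand d hη0, hs.eventually_gt_atTop 0,
    hy.eventually_gt_atTop 0, hb.eventually_gt_atTop 0, hexp,
    (tendsto_inv_atTop_zero.comp hy).eventually_lt_const (hFpos 0),
    (hs.const_div_atTop (2 * η)).eventually_lt_const (half_pos one_pos),
    (hs.const_div_atTop (α * M)).eventually_lt_const one_pos]
    with n hMn hdn hsn hyn hbn hexpn hinv hPhalf hαM
  simp only [Function.comp_apply] at hMn hdn hinv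
  set s := Real.sqrt (k n)
  set y := (n : ℝ) / k n
  set b := quantileB μ y
  rw [hexpn] at hMn hdn
  simp only [Real.exp_add, hexpn] at hMn hdn
  set P : ℝ := (y * tailDF μ b)⁻¹ with hPdef
  have hFb := hFpos b
  have hP0 : 0 < P := inv_pos.2 (mul_pos hyn hFb)
  have hPeq : P = y⁻¹ / tailDF μ b := by rw [hPdef, mul_inv, div_eq_mul_inv]
  have hPbound : s * |P - 1| ≤ 2 * η := by
    have hup := hdn d (abs_of_pos hd0).le
    have hlo := hdn (-d) (by rw [abs_neg, abs_of_pos hd0])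
    have hu1 : tailDF μ (b * Real.exp (d / s)) / tailDF μ b ≤ P := by
      rw [hPeq]
      refine div_le_div_of_nonneg_right (tailDF_le_inv_of_quantileB_lt hyn ?_) hFb.le
      exact lt_mul_of_one_lt_right hbn (Real.one_lt_exp_iff.2 (div_pos hd0 hsn))
    have hl1 : P ≤ tailDF μ (b * Real.exp (-d / s)) / tailDF μ b := by
      rw [hPeq]
      refine div_le_div_of_nonneg_right (inv_le_tailDF_of_lt_quantileB hinv ?_) hFb.le
      exact mul_lt_of_lt_one_right hbn
        (Real.exp_lt_one_iff.2 (div_neg_of_neg_of_pos (neg_neg_of_pos hd0) hsn))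
    set T₁ := tailDF μ (b * Real.exp (d / s)) / tailDF μ b
    set T₂ := tailDF μ (b * Real.exp (-d / s)) / tailDF μ b
    have he1 : s * (α * (d / s)) = η := by rw [← hαd]; field_simp
    have he2 : s * (α * (-d / s)) = -η := by rw [← hαd]; field_simp
    have h3 := mul_le_mul_of_nonneg_left hu1 hsn.le
    have h4 := mul_le_mul_of_nonneg_left hl1 hsn.le
    rw [← abs_of_pos hsn, ← abs_mul, abs_of_pos hsn] at hup hlo
    rw [← abs_of_pos hsn, ← abs_mul]
    have h1 := (abs_le.1 hup).1
    have h2 := (abs_le.1 hlo).2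
    rw [abs_le]
    constructor <;> linarith
  have hP_half : 1 / 2 ≤ P := by
    have h1 : |P - 1| ≤ 2 * η / s := (le_div_iff₀' hsn).2 hPbound
    linarith [(abs_le.1 h1).1]
  rw [Real.dist_eq, sub_zero, abs_of_nonneg (Real.iSup_nonneg fun ζ => by positivity)]
  refine (Real.iSup_le (fun ζ => ?_) (by positivity : 0 ≤ ε / 2)).trans_lt (half_lt_self hε)
  have hζ : |(ζ : ℝ)| ≤ M := hM ζ ζ.2
  have hT := hMn ζ hζ
  set T := tailDF μ (b * Real.exp ((ζ : ℝ) / s)) / tailDF μ b with hTdef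
  have hmain : y * tailDF μ (Real.exp ((ζ : ℝ) / s) * b) = T / P := by
    rw [hTdef, hPdef, mul_comm b]
    field_simp
  set w := α * ((ζ : ℝ) / s) with hw
  have hw1 : |w| ≤ 1 := by
    rw [hw, abs_mul, abs_div, abs_of_pos hα, abs_of_pos hsn, ← mul_div_assoc]
    exact (div_le_div_of_nonneg_right (mul_le_mul_of_nonneg_left hζ hα.le) hsn.le).trans hαM.le
  have hw2 : |1 - w| ≤ 2 := by
    rw [abs_le] at hw1 ⊢
    constructor <;> linarith
  rw [hmain, mul_div_assoc, ← hw,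
    show T / P - 1 + w = ((T - 1 + w) - (1 - w) * (P - 1)) / P by field_simp; ring,
    abs_div, abs_of_pos hP0, ← mul_div_assoc, div_le_iff₀ hP0]
  have hnum : s * |T - 1 + w - (1 - w) * (P - 1)| ≤ η + 2 * (2 * η) := by
    calc s * |T - 1 + w - (1 - w) * (P - 1)|
        ≤ s * (|T - 1 + w| + |1 - w| * |P - 1|) := by
          rw [← abs_mul]
          exact mul_le_mul_of_nonneg_left (abs_sub _ _) hsn.le
      _ = s * |T - 1 + w| + |1 - w| * (s * |P - 1|) := by ring
      _ ≤ η + 2 * (2 * η) :=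
          add_le_add hT (mul_le_mul hw2 hPbound (by positivity) (by norm_num))
  have : ε / 2 * (1 / 2) ≤ ε / 2 * P := mul_le_mul_of_nonneg_left hP_half (by positivity)
  linarith

end TailCusum
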